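/- Let $(\Omega, P)$ be a probability space, let $t_b > 0$ and let $t_w = m\,t_b$ for an integer $m \ge 1$, let $n \ge 2$ be an integer, and let $X_1, \dots, X_n : \Omega \to \mathbb{R}$ be independent random variables, each uniformly distributed on $[0, t_w]$. For $1 \le j \le m$, say the first occupied beacon interval is $j$ if at least one $X_i \in [(j-1)t_b, j\,t_b)$ and no $X_i < (j-1)t_b$. Then the probability of a collision — the event that the first occupied beacon interval contains at least two of the $X_i$ — equals $\sum_{j=1}^{m} \sum_{i=2}^{n} \binom{n}{i} \left(\frac{t_b}{t_w}\right)^i \left(1 - \frac{t_b}{t_w}\,j\right)^{n-i}$. -/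

import Mathlib

open MeasureTheory ProbabilityTheory

/-- The probability that a random variable uniform on `[0, tw]` lies in a subinterval of length
`b - a`. -/
lemma measure_preimage_Ico_of_map_eq_uniform {Ω : Type*} [MeasurableSpace Ω] {P : Measure Ω}
    {tw a b : ℝ} {X : Ω → ℝ} (htw : 0 < tw) (hX : Measurable X)
    (hunif : P.map X = ENNReal.ofReal (1 / tw) • volume.restrict (Set.Icc 0 tw))
    (ha : 0 ≤ a) (hb : b ≤ tw) :
    P (X ⁻¹' Set.Ico a b) = ENNReal.ofReal ((b - a) / tw) := by
  have hsub : Set.Ico a b ∩ Set.Icc 0 tw = Set.Ico a b :=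
    Set.inter_eq_left.2 fun x hx => ⟨ha.trans hx.1, hx.2.le.trans hb⟩
  rw [← Measure.map_apply hX measurableSet_Ico, hunif, Measure.smul_apply,
    Measure.restrict_apply measurableSet_Ico, hsub, Real.volume_Ico, smul_eq_mul,
    ← ENNReal.ofReal_mul (by positivity)]
  congr 1
  ring

/-- The probability that a random variable uniform on `[0, tw]` is at least `a`. -/
lemma measure_preimage_Ici_of_map_eq_uniform {Ω : Type*} [MeasurableSpace Ω] {P : Measure Ω}
    {tw a : ℝ} {X : Ω → ℝ} (htw : 0 < tw) (hX : Measurable X)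
    (hunif : P.map X = ENNReal.ofReal (1 / tw) • volume.restrict (Set.Icc 0 tw))
    (ha : 0 ≤ a) :
    P (X ⁻¹' Set.Ici a) = ENNReal.ofReal ((tw - a) / tw) := by
  have hsub : Set.Ici a ∩ Set.Icc 0 tw = Set.Icc a tw := by
    ext x
    simp only [Set.mem_inter_iff, Set.mem_Ici, Set.mem_Icc]
    exact ⟨fun h => ⟨h.1, h.2.2⟩, fun h => ⟨h.1, ha.trans h.1, h.2⟩⟩
  rw [← Measure.map_apply hX measurableSet_Ici, hunif, Measure.smul_apply,
    Measure.restrict_apply measurableSet_Ici, hsub, Real.volume_Icc, smul_eq_mul,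
    ← ENNReal.ofReal_mul (by positivity)]
  congr 1
  ring

/-- The event that the variables indexed by `s` lie in `[a, b)` and all others are at least `b`. -/
def exactOccupancy {Ω ι : Type*} [DecidableEq ι] (X : ι → Ω → ℝ) (a b : ℝ) (s : Finset ι) :
    Set Ω :=
  {ω | ∀ i, X i ω ∈ if i ∈ s then Set.Ico a b else Set.Ici b}

lemma mem_of_mem_exactOccupancy {Ω ι : Type*} [DecidableEq ι] {X : ι → Ω → ℝ} {a b : ℝ}
    {s : Finset ι} {ω : Ω} (h : ω ∈ exactOccupancy X a b s) (i : ι) : i ∈ s ↔ X i ω < b := by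
  have hi := h i
  split_ifs at hi with his
  · exact ⟨fun _ => hi.2, fun _ => his⟩
  · exact ⟨fun h => absurd h his, fun h => absurd h (not_lt.2 hi)⟩

lemma le_of_mem_exactOccupancy {Ω ι : Type*} [DecidableEq ι] {X : ι → Ω → ℝ} {a b : ℝ}
    {s : Finset ι} {ω : Ω} (hab : a ≤ b) (h : ω ∈ exactOccupancy X a b s) (i : ι) :
    a ≤ X i ω := by
  have hi := h i
  split_ifs at hi with his
  · exact hi.1
  · exact hab.trans hi

lemma measurableSet_exactOccupancy {Ω ι : Type*} [MeasurableSpace Ω] [Countable ι]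
    [DecidableEq ι] {X : ι → Ω → ℝ} (hX : ∀ i, Measurable (X i)) (a b : ℝ) (s : Finset ι) :
    MeasurableSet (exactOccupancy X a b s) := by
  rw [exactOccupancy, Set.ofPred_forall]
  refine MeasurableSet.iInter fun i => hX i ?_
  split_ifs
  exacts [measurableSet_Ico, measurableSet_Ici]

lemma measure_exactOccupancy {Ω ι : Type*} [MeasurableSpace Ω] [Fintype ι] [DecidableEq ι]
    {P : Measure Ω} {X : ι → Ω → ℝ} (hindep : iIndepFun X P) (a b : ℝ) (s : Finset ι)
    {p q : ENNReal} (hp : ∀ i, P (X i ⁻¹' Set.Ico a b) = p)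
    (hq : ∀ i, P (X i ⁻¹' Set.Ici b) = q) :
    P (exactOccupancy X a b s) = p ^ s.card * q ^ (Fintype.card ι - s.card) := by
  have h := hindep.measure_inter_preimage_eq_mul Finset.univ
    (sets := fun i => if i ∈ s then Set.Ico a b else Set.Ici b) (fun i _ => by
      split_ifs
      exacts [measurableSet_Ico, measurableSet_Ici])
  have hset : exactOccupancy X a b s
      = ⋂ i ∈ Finset.univ, X i ⁻¹' (if i ∈ s then Set.Ico a b else Set.Ici b) := by
    ext ω
    simp only [exactOccupancy, Set.mem_ofPred_eq, Set.mem_iInter, Set.mem_preimage,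
      Finset.mem_univ, true_imp_iff]
  have hfac : ∀ i, P (X i ⁻¹' (if i ∈ s then Set.Ico a b else Set.Ici b))
      = if i ∈ s then p else q := fun i => by
    split_ifs
    exacts [hp i, hq i]
  rw [hset, h, Finset.prod_congr rfl fun i _ => hfac i, Finset.prod_ite, Finset.prod_const,
    Finset.prod_const, Finset.filter_not, Finset.filter_univ_mem,
    ← Finset.compl_eq_univ_sdiff, Finset.card_compl]

lemma sum_filter_le_card_apply_card (n k : ℕ) (f : ℕ → ℝ) :
    ∑ s : Finset (Fin n) with k ≤ s.card, f s.card
      = ∑ i ∈ Finset.Icc k n, (n.choose i : ℝ) * f i := by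
  have h := Finset.sum_powerset_apply_card (fun i => if k ≤ i then f i else 0)
    (x := (Finset.univ : Finset (Fin n)))
  rw [Finset.powerset_univ, Finset.card_univ, Fintype.card_fin] at h
  rw [Finset.sum_filter, h]
  simp only [nsmul_eq_mul, mul_ite, mul_zero]
  rw [← Finset.sum_filter]
  refine Finset.sum_congr ?_ fun _ _ => rfl
  ext i
  simp only [Finset.mem_filter, Finset.mem_range, Finset.mem_Icc]
  omega

/-- Estreme's collision probability: with the wake-up period `[0, tw]` partitioned
into `m` beacon intervals of length `tb` (`tw = m·tb`), and `n ≥ 2` independent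
wake-up times uniform on `[0, tw]`, the probability that the first occupied beacon
interval contains at least two of the wake-up times equals
`∑_{j=1}^{m} ∑_{i=2}^{n} C(n,i) (tb/tw)^i (1 - (tb/tw)·j)^(n-i)`. -/
theorem estreme_collision_probability
    {Ω : Type*} [MeasurableSpace Ω] (P : Measure Ω) [IsProbabilityMeasure P]
    (tb tw : ℝ) (m : ℕ) (htb : 0 < tb) (hm : 1 ≤ m) (htw : tw = (m : ℝ) * tb)
    (n : ℕ) (hn : 2 ≤ n)
    (X : Fin n → Ω → ℝ)
    (hmeas : ∀ i, Measurable (X i))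
    (hindep : iIndepFun X P)
    (hunif : ∀ i, P.map (X i)
      = ENNReal.ofReal (1 / tw) • volume.restrict (Set.Icc 0 tw)) :
    P {ω | ∃ j ∈ Finset.Icc 1 m,
            2 ≤ (Finset.univ.filter
                  (fun idx => X idx ω ∈ Set.Ico (((j : ℝ) - 1) * tb) ((j : ℝ) * tb))).card
            ∧ ∀ idx, ¬ X idx ω < ((j : ℝ) - 1) * tb}
      = ENNReal.ofReal
          (∑ j ∈ Finset.Icc 1 m, ∑ i ∈ Finset.Icc 2 n,
            (n.choose i : ℝ) * (tb / tw) ^ i * (1 - (tb / tw) * (j : ℝ)) ^ (n - i)) := by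
  classical
  have hm0 : (0 : ℝ) < m := by exact_mod_cast hm
  have htw0 : 0 < tw := htw ▸ mul_pos hm0 htb
  set I : Finset (ℕ × Finset (Fin n)) :=
    Finset.Icc 1 m ×ˢ Finset.univ.filter (fun s : Finset (Fin n) => 2 ≤ s.card)
  set E : ℕ × Finset (Fin n) → Set Ω :=
    fun p => exactOccupancy X (((p.1 : ℝ) - 1) * tb) ((p.1 : ℝ) * tb) p.2
  have hab : ∀ j : ℕ, ((j : ℝ) - 1) * tb ≤ (j : ℝ) * tb := fun j => by nlinarith
  have hevent : {ω | ∃ j ∈ Finset.Icc 1 m,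
            2 ≤ (Finset.univ.filter
                  (fun idx => X idx ω ∈ Set.Ico (((j : ℝ) - 1) * tb) ((j : ℝ) * tb))).card
            ∧ ∀ idx, ¬ X idx ω < ((j : ℝ) - 1) * tb} = ⋃ p ∈ I, E p := by
    ext ω
    simp only [Set.mem_ofPred_eq, Set.mem_iUnion, exists_prop]
    constructor
    · rintro ⟨j, hj, hcard, hlow⟩
      refine ⟨(j, _), Finset.mem_product.2 ⟨hj, Finset.mem_filter.2 ⟨Finset.mem_univ _, hcard⟩⟩,
        fun i => ?_⟩
      split_ifs with hi
      · exact (Finset.mem_filter.1 hi).2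
      · by_contra hlt
        exact hi (Finset.mem_filter.2 ⟨Finset.mem_univ _, not_lt.1 (hlow i), not_le.1 hlt⟩)
    · rintro ⟨⟨j, s⟩, hp, hω⟩
      obtain ⟨hj, hs⟩ := Finset.mem_product.1 hp
      refine ⟨j, hj, (Finset.mem_filter.1 hs).2.trans (Finset.card_le_card fun i hi => ?_),
        fun i => not_lt.2 (le_of_mem_exactOccupancy (hab j) hω i)⟩
      exact Finset.mem_filter.2 ⟨Finset.mem_univ _, le_of_mem_exactOccupancy (hab j) hω i,
        (mem_of_mem_exactOccupancy hω i).1 hi⟩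
  have hle : ∀ p ∈ I, ∀ q ∈ I, ∀ ω, ω ∈ E p → ω ∈ E q → q.1 ≤ p.1 := by
    intro p hp q _ ω hωp hωq
    have hcard := (Finset.mem_filter.1 (Finset.mem_product.1 hp).2).2
    obtain ⟨i, hi⟩ := Finset.card_pos.1 (by omega : 0 < p.2.card)
    have h := (le_of_mem_exactOccupancy (hab q.1) hωq i).trans_lt
      ((mem_of_mem_exactOccupancy hωp i).1 hi)
    have hlt : (q.1 : ℝ) < p.1 + 1 := by linarith [lt_of_mul_lt_mul_right h htb.le]
    exact Nat.lt_succ_iff.1 (by exact_mod_cast hlt)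
  have hdisj : Set.PairwiseDisjoint (I : Set (ℕ × Finset (Fin n))) E := by
    intro p hp q hq hpq
    refine Set.disjoint_left.2 fun ω hωp hωq => hpq ?_
    have hj : p.1 = q.1 := le_antisymm (hle q hq p hp ω hωq hωp) (hle p hp q hq ω hωp hωq)
    refine Prod.ext hj (Finset.ext fun i => ?_)
    rw [mem_of_mem_exactOccupancy hωp i, mem_of_mem_exactOccupancy hωq i, hj]
  have hq0 : ∀ j ∈ Finset.Icc 1 m, 0 ≤ 1 - tb / tw * (j : ℝ) := fun j hj => by
    have hjm : (j : ℝ) ≤ m := by exact_mod_cast (Finset.mem_Icc.1 hj).2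
    rw [sub_nonneg, div_mul_eq_mul_div, div_le_one htw0, htw]
    nlinarith
  have hprob : ∀ p ∈ I, P (E p) = ENNReal.ofReal
      ((tb / tw) ^ p.2.card * (1 - tb / tw * (p.1 : ℝ)) ^ (n - p.2.card)) := by
    rintro ⟨j, s⟩ hp
    have hj := (Finset.mem_product.1 hp).1
    have hj1 : (1 : ℝ) ≤ j := by exact_mod_cast (Finset.mem_Icc.1 hj).1
    have hjm : (j : ℝ) ≤ m := by exact_mod_cast (Finset.mem_Icc.1 hj).2
    have h := measure_exactOccupancy hindep (((j : ℝ) - 1) * tb) ((j : ℝ) * tb) s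
      (fun i => measure_preimage_Ico_of_map_eq_uniform htw0 (hmeas i) (hunif i)
        (mul_nonneg (sub_nonneg.2 hj1) htb.le)
        (htw ▸ mul_le_mul_of_nonneg_right hjm htb.le))
      (fun i => measure_preimage_Ici_of_map_eq_uniform htw0 (hmeas i) (hunif i)
        (by positivity))
    have h1 : ((j : ℝ) * tb - ((j : ℝ) - 1) * tb) / tw = tb / tw := by ring
    have h2 : (tw - (j : ℝ) * tb) / tw = 1 - tb / tw * (j : ℝ) := by field_simp
    rw [h1, h2, Fintype.card_fin] at h
    rw [ENNReal.ofReal_mul (by positivity), ENNReal.ofReal_pow (by positivity),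
      ENNReal.ofReal_pow (hq0 j hj)]
    exact h
  rw [hevent, measure_biUnion_finset hdisj fun p _ => measurableSet_exactOccupancy hmeas _ _ _,
    Finset.sum_congr rfl hprob, ← ENNReal.ofReal_sum_of_nonneg fun p hp =>
      mul_nonneg (by positivity) (pow_nonneg (hq0 p.1 (Finset.mem_product.1 hp).1) _),
    Finset.sum_product]
  congr 1
  refine Finset.sum_congr rfl fun j _ => ?_
  rw [sum_filter_le_card_apply_card n 2
    (fun i => (tb / tw) ^ i * (1 - tb / tw * (j : ℝ)) ^ (n - i))]
  exact Finset.sum_congr rfl fun i _ => (mul_assoc _ _ _).symm
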